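/- For 1 < β < 2, the function t ↦ E_{β,2}(-t) has at most finitely many zeros in (0, ∞); consequently h = sup{t > 0 : E_{β,2}(-t) = 0} is finite (with h = 0 if there are no zeros). -/

import Mathlib

open Real

noncomputable def mittagLeffler (μ η z : ℝ) : ℝ := ∑' n : ℕ, z ^ n / Real.Gamma (μ * n + η)

open MeasureTheory ProbabilityTheory Set Filter Topology
open scoped Nat

/-- The Laplace transform of `x ^ (s - 1)` on the right half-plane. -/
lemma integral_rpow_mul_cexp_neg_mul_Ioi {s : ℝ} (hs : 0 < s) {p : ℂ} (hp : 0 < p.re) :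
    ∫ x : ℝ in Ioi 0, ((x ^ (s - 1) : ℝ) : ℂ) * Complex.exp (-p * x) =
      p ^ (-s : ℂ) * Gamma s := by
  set ν : Measure ℝ :=
    (volume.restrict (Ioi 0)).withDensity (fun x => ENNReal.ofReal (x ^ (s - 1))) with hν
  have hmeas : Measurable fun x : ℝ => ENNReal.ofReal (x ^ (s - 1)) := by fun_prop
  have hint (z : ℂ) : complexMGF id ν z =
      ∫ x : ℝ in Ioi 0, ((x ^ (s - 1) : ℝ) : ℂ) * Complex.exp (z * x) := by
    rw [complexMGF, hν, integral_withDensity_eq_integral_toReal_smul hmeas (by simp)]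
    refine setIntegral_congr_fun measurableSet_Ioi fun x hx => ?_
    simp only [ENNReal.toReal_ofReal (rpow_nonneg (le_of_lt hx) _), id, Complex.real_smul]
  have hset : Iio (0 : ℝ) ⊆ integrableExpSet id ν := by
    intro t ht
    rw [mem_Iio] at ht
    change Integrable _ _
    rw [hν, integrable_withDensity_iff hmeas (by simp)]
    have h := integrableOn_rpow_mul_exp_neg_mul_rpow (p := 1) (s := s - 1) (b := -t)
      (by linarith) one_pos (by linarith)
    refine (integrableOn_congr_fun (fun x hx => ?_) measurableSet_Ioi).mp h
    simp [ENNReal.toReal_ofReal (rpow_nonneg (le_of_lt hx) (s - 1)), mul_comm]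
  have han : AnalyticOnNhd ℂ (complexMGF id ν) {z | z.re < 0} :=
    analyticOnNhd_complexMGF.mono fun z hz => interior_maximal hset isOpen_Iio hz
  have han' : AnalyticOnNhd ℂ (fun z : ℂ => (-z) ^ (-s : ℂ) * Gamma s) {z | z.re < 0} := by
    refine DifferentiableOn.analyticOnNhd (fun z hz => ?_)
      (isOpen_Iio.preimage Complex.continuous_re)
    have : -z ∈ Complex.slitPlane := Or.inl (by simpa using hz)
    exact ((differentiableAt_id.neg.cpow_const this).mul_const _).differentiableWithinAt
  have hfreq : ∃ᶠ z in 𝓝[≠] (-1 : ℂ), complexMGF id ν z = (-z) ^ (-s : ℂ) * Gamma s := by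
    have hev : ∀ᶠ r : ℝ in 𝓝[≠] (1 : ℝ),
        complexMGF id ν (-(r : ℂ)) = (-(-(r : ℂ))) ^ (-s : ℂ) * Gamma s := by
      filter_upwards [nhdsWithin_le_nhds (lt_mem_nhds one_pos)] with r hr
      have h := congrArg (fun y : ℝ => (y : ℂ)) (integral_rpow_mul_exp_neg_mul_Ioi hs hr)
      rw [hint, neg_neg]
      push_cast at h
      rw [← integral_complex_ofReal] at h
      convert! h using 1
      · refine integral_congr_ae (.of_forall fun x => ?_)
        push_cast
        simp
      · rw [Complex.ofReal_cpow (by positivity), Complex.cpow_neg, one_div, Complex.ofReal_inv,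
          Complex.inv_cpow]
        rw [Complex.arg_ofReal_of_nonneg hr.le]; exact pi_pos.ne
    have htend : Tendsto (fun r : ℝ => -(r : ℂ)) (𝓝[≠] 1) (𝓝[≠] (-1)) := by
      refine tendsto_nhdsWithin_iff.mpr ⟨?_, ?_⟩
      · have : Continuous fun r : ℝ => -(r : ℂ) := by fun_prop
        simpa using (this.tendsto 1).mono_left nhdsWithin_le_nhds
      · filter_upwards [self_mem_nhdsWithin] with r hr
        simpa using hr
    exact htend.frequently hev.frequently
  have hconv : IsPreconnected {z : ℂ | z.re < 0} :=
    (convex_halfSpace_re_lt 0).isPreconnected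
  have := han.eqOn_of_preconnected_of_frequently_eq han' hconv
    (show (-1 : ℂ) ∈ {z : ℂ | z.re < 0} by simp) hfreq (show -p ∈ {z : ℂ | z.re < 0} by simpa)
  rw [hint] at this
  simpa using this

lemma integrable_norm_add_mul_I_rpow_neg {c s : ℝ} (hc : 0 < c) (hs : 1 < s) :
    Integrable fun τ : ℝ => ‖(c + τ * Complex.I : ℂ)‖ ^ (-s) := by
  have h := (integrable_one_add_norm (E := ℝ) (μ := volume) (r := s) (by simpa)).const_mul
    ((1 / c + 1) ^ s)
  refine h.mono' (Continuous.aestronglyMeasurable ?_) (.of_forall fun τ => ?_)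
  · refine Continuous.rpow_const (by fun_prop) fun τ => Or.inl ?_
    intro h0
    have := congrArg Complex.re (norm_eq_zero.mp h0)
    simp at this
    exact hc.ne' this
  · have h1 : c ≤ ‖(c + τ * Complex.I : ℂ)‖ := by
      simpa [abs_of_pos hc] using Complex.abs_re_le_norm (c + τ * Complex.I : ℂ)
    have h2 : |τ| ≤ ‖(c + τ * Complex.I : ℂ)‖ := by
      simpa using Complex.abs_im_le_norm (c + τ * Complex.I : ℂ)
    set ρ := ‖(c + τ * Complex.I : ℂ)‖
    have hρ : 0 < ρ := hc.trans_le h1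
    have h3 : 1 + |τ| ≤ (1 / c + 1) * ρ := by
      have : 1 ≤ 1 / c * ρ := by rw [one_div, inv_mul_eq_div]; exact (one_le_div hc).mpr h1
      linarith
    rw [norm_of_nonneg (by positivity), rpow_neg hρ.le, rpow_neg (by positivity), norm_eq_abs,
      ← div_eq_mul_inv, ← div_rpow (by positivity) (by positivity), ← inv_rpow hρ.le]
    refine rpow_le_rpow (by positivity) ?_ (by linarith)
    rw [le_div_iff₀ (by positivity), inv_mul_le_iff₀ hρ]
    linarith

lemma integrable_cexp_mul_cpow_neg {c s x : ℝ} (hc : 0 < c) (hs : 1 < s) :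
    Integrable fun τ : ℝ =>
      Complex.exp ((c + τ * Complex.I) * x) * (c + τ * Complex.I : ℂ) ^ (-s : ℂ) := by
  have h := (integrable_norm_add_mul_I_rpow_neg hc hs).const_mul (exp (c * x))
  refine h.mono' (Continuous.aestronglyMeasurable ?_) (.of_forall fun τ => ?_)
  · refine Continuous.mul (by fun_prop) (Continuous.cpow (by fun_prop) (by fun_prop) fun τ => ?_)
    exact Or.inl (by simpa)
  · rw [norm_mul, Complex.norm_exp, ← Complex.ofReal_neg, Complex.norm_cpow_real]
    simp

/-- The inverse Laplace transform of `p ^ (-s)` along a vertical line. -/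
lemma integral_cexp_mul_cpow_neg {c s x : ℝ} (hc : 0 < c) (hs : 1 < s) (hx : 0 < x) :
    ∫ τ : ℝ, Complex.exp ((c + τ * Complex.I) * x) * (c + τ * Complex.I : ℂ) ^ (-s : ℂ) =
      ((2 * π * (x ^ (s - 1) / Gamma s) : ℝ) : ℂ) := by
  set g : ℝ → ℂ := (Ioi (0 : ℝ)).indicator fun y => ((y ^ (s - 1) * exp (-c * y) : ℝ) : ℂ) with hg
  have hgi : Integrable g := by
    rw [hg, integrable_indicator_iff measurableSet_Ioi]
    have h := integrableOn_rpow_mul_exp_neg_mul_rpow (p := 1) (s := s - 1) (b := c)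
      (by linarith) one_pos hc
    simp only [rpow_one] at h
    exact h.ofReal
  have hF (ξ : ℝ) : FourierTransform.fourier g ξ =
      (c + (2 * π * ξ : ℝ) * Complex.I : ℂ) ^ (-s : ℂ) * Gamma s := by
    rw [Real.fourier_real_eq_integral_exp_smul,
      ← integral_rpow_mul_cexp_neg_mul_Ioi (by linarith) (by simpa), ← integral_indicator
        measurableSet_Ioi]
    congr 1
    ext y
    by_cases hy : y ∈ Ioi (0 : ℝ)
    · simp only [hg, indicator_of_mem hy, smul_eq_mul]
      push_cast
      rw [mul_left_comm, ← Complex.exp_add]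
      congr 2
      ring
    · simp [hg, indicator_of_notMem hy]
  have hFi : Integrable (FourierTransform.fourier g) := by
    have h : Integrable fun τ : ℝ => (c + τ * Complex.I : ℂ) ^ (-s : ℂ) := by
      simpa using integrable_cexp_mul_cpow_neg (x := 0) hc hs
    have h2 := (h.comp_mul_left' (R := 2 * π) (by positivity)).mul_const ((Gamma s : ℝ) : ℂ)
    exact h2.congr (.of_forall fun ξ => (hF ξ).symm)
  have hgc : ContinuousAt g x := by
    have : ContinuousAt (fun y : ℝ => ((y ^ (s - 1) * exp (-c * y) : ℝ) : ℂ)) x := by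
      refine Complex.continuous_ofReal.continuousAt.comp
        (ContinuousAt.mul (continuousAt_rpow_const _ _ (Or.inl hx.ne')) (by fun_prop))
    refine this.congr ?_
    filter_upwards [Ioi_mem_nhds hx] with y hy
    rw [hg, indicator_of_mem hy]
  have hinv := hgi.fourierInv_fourier_eq hFi hgc
  rw [Real.fourierInv_eq'] at hinv
  simp only [hF] at hinv
  rw [hg, indicator_of_mem (mem_Ioi.mpr hx)] at hinv
  have hchange := Measure.integral_comp_mul_left (fun τ : ℝ =>
    Complex.exp ((c + τ * Complex.I) * x) * (c + τ * Complex.I : ℂ) ^ (-s : ℂ)) (2 * π)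
  have hG : (Gamma s : ℂ) ≠ 0 := by
    exact_mod_cast (Gamma_pos_of_pos (by linarith)).ne'
  have hrel : (∫ ξ : ℝ, Complex.exp ((c + (2 * π * ξ : ℝ) * Complex.I) * x) *
      (c + (2 * π * ξ : ℝ) * Complex.I : ℂ) ^ (-s : ℂ)) * Gamma s =
      Complex.exp (c * x) * ((x ^ (s - 1) * exp (-c * x) : ℝ) : ℂ) := by
    rw [← hinv, ← integral_mul_const, ← integral_const_mul]
    congr 1
    ext ξ
    have : Complex.exp ((c + (2 * π * ξ : ℝ) * Complex.I) * x) =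
        Complex.exp (c * x) * Complex.exp ((2 * π * inner ℝ ξ x : ℝ) * Complex.I) := by
      rw [← Complex.exp_add]
      congr 1
      simp
      ring
    rw [this, smul_eq_mul]
    ring
  rw [hchange, abs_of_pos (by positivity), Complex.real_smul] at hrel
  have hexp : Complex.exp (c * x) * ((x ^ (s - 1) * exp (-c * x) : ℝ) : ℂ) =
      ((x ^ (s - 1) : ℝ) : ℂ) := by
    push_cast
    rw [mul_left_comm, ← Complex.exp_add]
    simp
  rw [hexp] at hrel
  have hpi : (π : ℂ) ≠ 0 := by exact_mod_cast pi_ne_zero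
  push_cast at hrel ⊢
  rw [← hrel, mul_div_cancel_right₀ _ hG, mul_inv_cancel_left₀ (by simp)]

/-- The integrand left in the inverse Laplace transform of `x ^ 2 * E_{β,2}(-x ^ β)` after the
leading term `(2 - β) * p ^ (β - 3)` is removed. -/
noncomputable def laplaceRemainder (β : ℝ) (p : ℂ) : ℂ :=
  p ^ ((2 * β - 3 : ℝ) : ℂ) * (β / (1 + p ^ (β : ℂ)) ^ 2 - (2 - β) / (1 + p ^ (β : ℂ)))

lemma mul_one_add_norm_rpow_le_norm_one_add_cpow {β : ℝ} (hβ0 : 0 ≤ β) (hβ2 : β ≤ 2) {p : ℂ}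
    (hp : 0 < p.re) :
    cos (β * π / 4) * (1 + ‖p‖ ^ β) ≤ ‖1 + p ^ (β : ℂ)‖ := by
  have harg := Complex.abs_arg_lt_pi_div_two_iff.mpr (Or.inl hp)
  set r := ‖p‖ ^ β with hr
  have hr0 : 0 ≤ r := by positivity
  set k := cos (p.arg * β / 2) with hk
  have hkk : cos (β * π / 4) ≤ k := by
    rw [hk, ← cos_abs (p.arg * β / 2), abs_div, abs_mul, abs_of_nonneg hβ0, abs_two]
    refine cos_le_cos_of_nonneg_of_le_pi (by positivity) ?_ ?_ <;> nlinarith [pi_pos]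
  have hcos : cos (p.arg * β) = 2 * k ^ 2 - 1 := by
    rw [hk, ← cos_two_mul]; congr 1; ring
  refine (mul_le_mul_of_nonneg_right hkk (by positivity)).trans ?_
  refine le_of_sq_le_sq ?_ (norm_nonneg _)
  rw [← Complex.normSq_eq_norm_sq, Complex.normSq_apply]
  simp only [Complex.add_re, Complex.one_re, Complex.add_im, Complex.one_im, zero_add,
    Complex.cpow_ofReal_re, Complex.cpow_ofReal_im, ← hr, hcos]
  have hs : sin (p.arg * β) ^ 2 = 1 - (2 * k ^ 2 - 1) ^ 2 := by rw [sin_sq, hcos]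
  have : 0 ≤ (1 - r) ^ 2 * (1 - k ^ 2) :=
    mul_nonneg (sq_nonneg _) (by linarith [cos_sq_le_one (p.arg * β / 2)])
  nlinarith [congrArg (fun y => r ^ 2 * y) hs]

lemma cos_mul_pi_div_four_pos {β : ℝ} (hβ0 : 0 ≤ β) (hβ2 : β < 2) : 0 < cos (β * π / 4) :=
  cos_pos_of_mem_Ioo ⟨by nlinarith [pi_pos], by nlinarith [pi_pos]⟩

lemma one_add_cpow_ne_zero {β : ℝ} (hβ0 : 0 ≤ β) (hβ2 : β < 2) {p : ℂ} (hp : 0 < p.re) :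
    1 + p ^ (β : ℂ) ≠ 0 := by
  have := mul_one_add_norm_rpow_le_norm_one_add_cpow hβ0 hβ2.le hp
  have hk := cos_mul_pi_div_four_pos hβ0 hβ2
  exact norm_pos_iff.mp (lt_of_lt_of_le (by positivity) this)

lemma norm_laplaceRemainder_le {β : ℝ} (hβ1 : 1 < β) (hβ2 : β < 2) {p : ℂ} (hp : 0 < p.re)
    (him : p.im ≠ 0) :
    ‖laplaceRemainder β p‖ ≤ 4 / cos (β * π / 4) ^ 2 * (|p.im| ^ (β - 2) / (1 + |p.im|)) := by
  have hδ := cos_mul_pi_div_four_pos (by linarith) hβ2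
  have hlow := mul_one_add_norm_rpow_le_norm_one_add_cpow (by linarith) hβ2.le hp
  have hδ1 := cos_le_one (β * π / 4)
  set δ := cos (β * π / 4)
  have hτ : 0 < |p.im| := abs_pos.mpr him
  have hτρ : |p.im| ≤ ‖p‖ := Complex.abs_im_le_norm p
  set ρ := ‖p‖
  have hρ : 0 < ρ := hτ.trans_le hτρ
  set w := 1 + p ^ (β : ℂ)
  have hrβ : 0 < ρ ^ β := by positivity
  have hw : 0 < ‖w‖ := lt_of_lt_of_le (by positivity) hlow
  have hfac : ‖(β / w ^ 2 - (2 - β) / w : ℂ)‖ ≤ 2 / δ ^ 2 / (1 + ρ ^ β) := by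
    have e1 : 1 / ‖w‖ ≤ 1 / δ ^ 2 / (1 + ρ ^ β) := by
      rw [div_div]
      refine one_div_le_one_div_of_le (by positivity) (le_trans ?_ hlow)
      exact mul_le_mul_of_nonneg_right (by nlinarith) (by positivity)
    have e2 : 1 / ‖w‖ ^ 2 ≤ 1 / δ ^ 2 / (1 + ρ ^ β) := by
      rw [div_div]
      refine one_div_le_one_div_of_le (by positivity) ?_
      calc δ ^ 2 * (1 + ρ ^ β) ≤ (δ * (1 + ρ ^ β)) ^ 2 := by
            rw [mul_pow]
            exact mul_le_mul_of_nonneg_left (by nlinarith) (by positivity)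
        _ ≤ ‖w‖ ^ 2 := pow_le_pow_left₀ (by positivity) hlow 2
    calc ‖(β / w ^ 2 - (2 - β) / w : ℂ)‖ ≤ ‖(β / w ^ 2 : ℂ)‖ + ‖((2 - β) / w : ℂ)‖ :=
          norm_sub_le _ _
      _ = β * (1 / ‖w‖ ^ 2) + (2 - β) * (1 / ‖w‖) := by
          have : ‖(2 - β : ℂ)‖ = 2 - β := by
            rw [show (2 - β : ℂ) = ((2 - β : ℝ) : ℂ) by push_cast; rfl, Complex.norm_real,
              norm_of_nonneg (by linarith)]
          rw [norm_div, norm_div, this, norm_pow, Complex.norm_real,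
            norm_of_nonneg (by linarith)]
          ring
      _ ≤ β * (1 / δ ^ 2 / (1 + ρ ^ β)) + (2 - β) * (1 / δ ^ 2 / (1 + ρ ^ β)) := by
          have := sub_pos.mpr hβ2
          gcongr
      _ = 2 / δ ^ 2 / (1 + ρ ^ β) := by ring
  have hpow : ρ ^ (2 * β - 3) / (1 + ρ ^ β) ≤ 2 * (ρ ^ (β - 2) / (1 + ρ)) := by
    have h1 : ρ ^ (2 * β - 3) = ρ ^ (β - 2) * ρ ^ (β - 1) := by
      rw [← rpow_add hρ]; congr 1; ring
    have h2 : ρ ^ β = ρ ^ (β - 1) * ρ := by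
      rw [← rpow_add_one hρ.ne']; congr 1; ring
    have h3 : ρ ^ (β - 1) ≤ 1 + ρ ^ β := by
      rcases le_total ρ 1 with h | h
      · linarith [rpow_le_one hρ.le h (by linarith : 0 ≤ β - 1)]
      · linarith [rpow_le_rpow_of_exponent_le h (by linarith : β - 1 ≤ β)]
    have h4 : ρ ^ (β - 1) / (1 + ρ ^ β) ≤ 2 / (1 + ρ) := by
      rw [div_le_div_iff₀ (by positivity) (by positivity)]
      nlinarith
    calc ρ ^ (2 * β - 3) / (1 + ρ ^ β) = ρ ^ (β - 2) * (ρ ^ (β - 1) / (1 + ρ ^ β)) := by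
          rw [h1, mul_div_assoc]
      _ ≤ ρ ^ (β - 2) * (2 / (1 + ρ)) := by gcongr
      _ = _ := by ring
  have hmono : ρ ^ (β - 2) / (1 + ρ) ≤ |p.im| ^ (β - 2) / (1 + |p.im|) := by
    have := rpow_le_rpow_of_nonpos hτ hτρ (by linarith : β - 2 ≤ 0)
    gcongr
  calc ‖laplaceRemainder β p‖
      = ρ ^ (2 * β - 3) * ‖(β / w ^ 2 - (2 - β) / w : ℂ)‖ := by
        rw [laplaceRemainder, norm_mul, Complex.norm_cpow_real]
    _ ≤ ρ ^ (2 * β - 3) * (2 / δ ^ 2 / (1 + ρ ^ β)) := by gcongr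
    _ = 2 / δ ^ 2 * (ρ ^ (2 * β - 3) / (1 + ρ ^ β)) := by ring
    _ ≤ 2 / δ ^ 2 * (2 * (|p.im| ^ (β - 2) / (1 + |p.im|))) := by
        gcongr
        exact hpow.trans (by gcongr)
    _ = _ := by ring

lemma integrable_abs_rpow_div_one_add_abs {a : ℝ} (ha : -1 < a) (ha0 : a < 0) :
    Integrable fun τ : ℝ => |τ| ^ a / (1 + |τ|) := by
  have h : IntegrableOn (fun τ : ℝ => τ ^ a / (1 + τ)) (Ioi 0) := by
    have hm (S : Set ℝ) : AEStronglyMeasurable (fun τ : ℝ => τ ^ a / (1 + τ))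
        (volume.restrict S) :=
      Measurable.aestronglyMeasurable (by fun_prop)
    rw [← Ioc_union_Ioi_eq_Ioi zero_le_one]
    refine IntegrableOn.union ?_ ?_
    · have h1 := (intervalIntegral.intervalIntegrable_rpow' (a := 0) (b := 1) ha).1
      refine Integrable.mono' h1 (hm _) ?_
      filter_upwards [ae_restrict_mem measurableSet_Ioc] with τ hτ
      have := hτ.1
      rw [norm_of_nonneg (by positivity)]
      exact div_le_self (by positivity) (by linarith)
    · have h1 := integrableOn_Ioi_rpow_of_lt (by linarith : a - 1 < -1) one_pos
      refine Integrable.mono' h1 (hm _) ?_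
      filter_upwards [ae_restrict_mem measurableSet_Ioi] with τ hτ
      have : 0 < τ := one_pos.trans hτ
      rw [norm_of_nonneg (by positivity), rpow_sub_one this.ne']
      gcongr
      linarith
  have := (integrable_fun_norm_addHaar (E := ℝ) volume
    (f := fun τ : ℝ => τ ^ a / (1 + τ))).mpr (by simpa using h)
  simpa [norm_eq_abs] using this

lemma continuous_laplaceRemainder_vertical {β c : ℝ} (hβ0 : 0 ≤ β) (hβ2 : β < 2) (hc : 0 < c) :
    Continuous fun τ : ℝ => laplaceRemainder β (c + τ * Complex.I) := by
  have hre (τ : ℝ) : 0 < (c + τ * Complex.I : ℂ).re := by simpa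
  have hcp (r : ℝ) : Continuous fun τ : ℝ => (c + τ * Complex.I : ℂ) ^ (r : ℂ) :=
    Continuous.cpow (by fun_prop) (by fun_prop) fun τ => Or.inl (hre τ)
  have hne (τ : ℝ) := one_add_cpow_ne_zero hβ0 hβ2 (hre τ)
  unfold laplaceRemainder
  refine (hcp _).mul (.sub (continuous_const.div ?_ fun τ => pow_ne_zero 2 (hne τ))
    (continuous_const.div ?_ hne))
  · exact (continuous_const.add (hcp β)).pow 2
  · exact continuous_const.add (hcp β)

lemma differentiableAt_laplaceRemainder {β : ℝ} (hβ0 : 0 ≤ β) (hβ2 : β < 2) {p : ℂ}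
    (hp : 0 < p.re) : DifferentiableAt ℂ (laplaceRemainder β) p := by
  have hcp (r : ℝ) : DifferentiableAt ℂ (fun p : ℂ => p ^ (r : ℂ)) p :=
    differentiableAt_id.cpow_const (Or.inl hp)
  have hne := one_add_cpow_ne_zero hβ0 hβ2 hp
  unfold laplaceRemainder
  exact (hcp _).mul (.sub (.div (by fun_prop) (((hcp β).const_add 1).pow 2) (pow_ne_zero 2 hne))
    (.div (by fun_prop) ((hcp β).const_add 1) hne))

lemma norm_cexp_mul_laplaceRemainder_le {β c x τ : ℝ} (hβ1 : 1 < β) (hβ2 : β < 2) (hc : 0 < c)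
    (hτ : τ ≠ 0) :
    ‖Complex.exp ((c + τ * Complex.I) * x) * laplaceRemainder β (c + τ * Complex.I)‖ ≤
      exp (c * x) * (4 / cos (β * π / 4) ^ 2) * (|τ| ^ (β - 2) / (1 + |τ|)) := by
  have := norm_laplaceRemainder_le hβ1 hβ2 (p := c + τ * Complex.I) (by simpa) (by simpa)
  rw [norm_mul, Complex.norm_exp, mul_assoc]
  simp only [Complex.add_im, Complex.ofReal_im, Complex.mul_im, Complex.ofReal_re, Complex.I_im,
    mul_one, Complex.I_re, mul_zero, add_zero, zero_add] at this
  gcongr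
  simp

lemma integrable_cexp_mul_laplaceRemainder {β c x : ℝ} (hβ1 : 1 < β) (hβ2 : β < 2)
    (hc : 0 < c) :
    Integrable fun τ : ℝ =>
      Complex.exp ((c + τ * Complex.I) * x) * laplaceRemainder β (c + τ * Complex.I) := by
  refine ((integrable_abs_rpow_div_one_add_abs (a := β - 2) (by linarith)
    (by linarith)).const_mul (exp (c * x) * (4 / cos (β * π / 4) ^ 2))).mono' ?_ ?_
  · exact (Continuous.mul (by fun_prop)
      (continuous_laplaceRemainder_vertical (by linarith) hβ2 hc)).aestronglyMeasurable
  · filter_upwards [compl_mem_ae_iff.mpr (measure_singleton (0 : ℝ))] with τ hτ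
    exact norm_cexp_mul_laplaceRemainder_le hβ1 hβ2 hc hτ

lemma norm_integral_cexp_mul_laplaceRemainder_le {β c x : ℝ} (hβ1 : 1 < β) (hβ2 : β < 2)
    (hc : 0 < c) :
    ‖∫ τ : ℝ, Complex.exp ((c + τ * Complex.I) * x) * laplaceRemainder β (c + τ * Complex.I)‖ ≤
      exp (c * x) * (4 / cos (β * π / 4) ^ 2) * ∫ τ : ℝ, |τ| ^ (β - 2) / (1 + |τ|) := by
  rw [← integral_const_mul]
  refine norm_integral_le_of_norm_le ((integrable_abs_rpow_div_one_add_abs (by linarith)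
    (by linarith)).const_mul _) ?_
  filter_upwards [compl_mem_ae_iff.mpr (measure_singleton (0 : ℝ))] with τ hτ
  exact norm_cexp_mul_laplaceRemainder_le hβ1 hβ2 hc hτ

/-- The contour of the inverse Laplace integral of `laplaceRemainder` may be shifted. -/
lemma integral_cexp_mul_laplaceRemainder_eq {β c d x : ℝ} (hβ1 : 1 < β) (hβ2 : β < 2)
    (hc : 0 < c) (hd : 0 < d) :
    ∫ τ : ℝ, Complex.exp ((c + τ * Complex.I) * x) * laplaceRemainder β (c + τ * Complex.I) =
      ∫ τ : ℝ, Complex.exp ((d + τ * Complex.I) * x) * laplaceRemainder β (d + τ * Complex.I) := by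
  set f : ℂ → ℂ := fun p => Complex.exp (p * x) * laplaceRemainder β p with hf
  have hvert {a : ℝ} (ha : 0 < a) : Tendsto (fun T : ℝ => ∫ τ in -T..T, f (a + τ * Complex.I))
      atTop (𝓝 (∫ τ : ℝ, f (a + τ * Complex.I))) :=
    intervalIntegral_tendsto_integral (integrable_cexp_mul_laplaceRemainder hβ1 hβ2 ha)
      tendsto_neg_atTop_atBot tendsto_id
  have hpos {u : ℝ} (hu : u ∈ uIcc c d) : 0 < u := (lt_min hc hd).trans_le hu.1
  set K := exp (max (c * x) (d * x)) * (4 / cos (β * π / 4) ^ 2) with hK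
  have hbound {u τ : ℝ} (hu : u ∈ uIcc c d) (hτ : τ ≠ 0) :
      ‖f (u + τ * Complex.I)‖ ≤ K * (|τ| ^ (β - 2) / (1 + |τ|)) := by
    refine (norm_cexp_mul_laplaceRemainder_le hβ1 hβ2 (hpos hu) hτ).trans ?_
    rw [hK]
    gcongr
    have hmem : u * x ∈ uIcc (c * x) (d * x) := by
      rw [← image_mul_const_uIcc]
      exact ⟨u, hu, rfl⟩
    exact hmem.2
  have hdecay : Tendsto (fun T : ℝ => K * (T ^ (β - 2) / (1 + T)) * |d - c|) atTop (𝓝 0) := by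
    have h1 : Tendsto (fun T : ℝ => T ^ (β - 2)) atTop (𝓝 0) := by
      simpa using tendsto_rpow_neg_atTop (y := 2 - β) (by linarith)
    have h2 : Tendsto (fun T : ℝ => 1 + T) atTop atTop :=
      tendsto_atTop_add_const_left _ _ tendsto_id
    simpa using ((h1.div_atTop h2).const_mul K).mul_const |d - c|
  have hhor {ε : ℝ} (hε : |ε| = 1) : Tendsto
      (fun T : ℝ => ∫ u in c..d, f (u + ((ε * T : ℝ) : ℂ) * Complex.I)) atTop (𝓝 0) := by
    refine squeeze_zero_norm' ?_ hdecay
    filter_upwards [eventually_gt_atTop 0] with T hT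
    refine intervalIntegral.norm_integral_le_of_norm_le_const fun u hu => ?_
    have hε0 : ε ≠ 0 := by rintro rfl; simp at hε
    have := hbound (uIoc_subset_uIcc hu) (mul_ne_zero hε0 hT.ne')
    rwa [abs_mul, hε, one_mul, abs_of_pos hT] at this
  have hrect (T : ℝ) : (∫ u in c..d, f (u + ((-1 * T : ℝ) : ℂ) * Complex.I)) -
      (∫ u in c..d, f (u + ((1 * T : ℝ) : ℂ) * Complex.I)) +
      Complex.I * (∫ τ in -T..T, f (d + τ * Complex.I)) -
      Complex.I * (∫ τ in -T..T, f (c + τ * Complex.I)) = 0 := by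
    have h := Complex.integral_boundary_rect_eq_zero_of_differentiableOn f ⟨c, -T⟩ ⟨d, T⟩
      fun p hp => by
        have := differentiableAt_laplaceRemainder (by linarith) hβ2 (hpos hp.1)
        exact (DifferentiableAt.mul (by fun_prop) this).differentiableWithinAt
    simpa [smul_eq_mul] using h
  have hlim := ((((hhor (ε := -1) (by simp)).sub (hhor (ε := 1) (by simp))).add
    ((hvert hd).const_mul Complex.I)).sub ((hvert hc).const_mul Complex.I)).congr hrect
  have := tendsto_nhds_unique hlim tendsto_const_nhds
  rw [sub_zero, zero_add, ← mul_sub, mul_eq_zero, sub_eq_zero] at this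
  exact (this.resolve_left Complex.I_ne_zero).symm

lemma hasSum_add_mul_neg_pow {q : ℂ} (hq : ‖q‖ < 1) (β : ℂ) :
    HasSum (fun n : ℕ => (β * n + 2) * (-q) ^ n) (2 / (1 + q) - β * q / (1 + q) ^ 2) := by
  have hq' : ‖-q‖ < 1 := by rwa [norm_neg]
  have h1 := (hasSum_coe_mul_geometric_of_norm_lt_one hq').mul_left β
  have h2 := (hasSum_geometric_of_norm_lt_one hq').mul_left 2
  convert! h1.add h2 using 1
  · ext n; ring
  · rw [sub_neg_eq_add]; ring

/-- The inverse Laplace representation of `x ^ 2 * E_{β,2}(-x ^ β)`. -/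
lemma integral_cexp_mul_laplaceRemainder {β c x : ℝ} (hβ1 : 1 < β) (hβ2 : β < 2) (hc : 1 < c)
    (hx : 0 < x) :
    ∫ τ : ℝ, Complex.exp ((c + τ * Complex.I) * x) * laplaceRemainder β (c + τ * Complex.I) =
      ((2 * π * (x ^ 2 * mittagLeffler β 2 (-x ^ β) -
        (2 - β) * (x ^ (2 - β) / Gamma (3 - β))) : ℝ) : ℂ) := by
  have hc0 : 0 < c := by linarith
  have hβ0 : 0 < β := by linarith
  set P : ℝ → ℂ := fun τ => c + τ * Complex.I with hP
  have hPre (τ : ℝ) : 0 < (P τ).re := by simpa [hP]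
  have hP0 (τ : ℝ) : P τ ≠ 0 := fun h => (hPre τ).ne' (by rw [h]; rfl)
  have hPc (τ : ℝ) : c ≤ ‖P τ‖ := by
    simpa [hP, abs_of_pos hc0] using Complex.abs_re_le_norm (P τ)
  set F : ℕ → ℝ → ℂ := fun n τ => ((β * n + 2) * (-1) ^ n : ℝ) *
    (Complex.exp (P τ * x) * P τ ^ (-(β * n + 3 : ℝ) : ℂ)) with hF
  have hcb : c ^ (-β) < 1 := rpow_lt_one_of_one_lt_of_neg hc (by linarith)
  have hs (n : ℕ) : 1 < β * n + 3 := by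
    have : 0 ≤ β * n := by positivity
    linarith
  have hFint (n : ℕ) : Integrable (F n) :=
    (integrable_cexp_mul_cpow_neg hc0 (hs n)).const_mul _
  have hFval (n : ℕ) : ∫ τ, F n τ =
      ((2 * π * (x ^ 2 * ((-x ^ β) ^ n / Gamma (β * n + 2))) : ℝ) : ℂ) := by
    rw [hF, integral_const_mul, integral_cexp_mul_cpow_neg hc0 (hs n) hx, ← Complex.ofReal_mul]
    congr 1
    have h2 : β * n + 2 ≠ 0 := by positivity
    have hG : Gamma (β * n + 2) ≠ 0 := (Gamma_pos_of_pos (by positivity)).ne'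
    rw [show β * n + 3 = (β * n + 2) + 1 by ring, Gamma_add_one h2, add_sub_cancel_right,
      rpow_add hx, rpow_mul hx.le, rpow_natCast, rpow_two, neg_pow (x ^ β)]
    field_simp
  have hsum : Summable fun n => ∫ τ, ‖F n τ‖ := by
    have hgeo : Summable fun n : ℕ => (β * n + 2) * (c ^ (-β)) ^ n := by
      have hn : ‖c ^ (-β)‖ < 1 := by rwa [norm_of_nonneg (by positivity)]
      convert! ((hasSum_coe_mul_geometric_of_norm_lt_one hn).summable.mul_left β).add
        ((summable_geometric_of_norm_lt_one hn).mul_left 2) using 2 with n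
      ring
    refine .of_nonneg_of_le (fun n => integral_nonneg fun τ => norm_nonneg _) (fun n => ?_)
      (hgeo.mul_right (exp (c * x) * ∫ τ, ‖P τ‖ ^ (-3 : ℝ)))
    rw [← integral_const_mul, ← integral_const_mul]
    refine integral_mono (hFint n).norm (((integrable_norm_add_mul_I_rpow_neg hc0
      (by norm_num)).const_mul _).const_mul _) fun τ => ?_
    have hρ : 0 < ‖P τ‖ := norm_pos_iff.mpr (hP0 τ)
    have hpow : ‖P τ‖ ^ (-(β * n + 3)) ≤ (c ^ (-β)) ^ n * ‖P τ‖ ^ (-3 : ℝ) := by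
      rw [show -(β * n + 3) = -β * n + -3 by ring, rpow_add hρ, rpow_mul hρ.le, rpow_natCast]
      have := rpow_le_rpow_of_nonpos hc0 (hPc τ) (by linarith : -β ≤ 0)
      gcongr
    have hre : (P τ * x).re = c * x := by simp [hP]
    simp only [hF]
    rw [norm_mul, norm_mul, Complex.norm_exp, hre, ← Complex.ofReal_neg, Complex.norm_cpow_real,
      Complex.norm_real, norm_mul, norm_pow, norm_neg, norm_one, one_pow, mul_one,
      norm_of_nonneg (by positivity)]
    calc (β * n + 2) * (exp (c * x) * ‖P τ‖ ^ (-(β * n + 3)))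
        ≤ (β * n + 2) * (exp (c * x) * ((c ^ (-β)) ^ n * ‖P τ‖ ^ (-3 : ℝ))) := by gcongr
      _ = _ := by ring
  have htsum (τ : ℝ) : ∑' n, F n τ = Complex.exp (P τ * x) * laplaceRemainder β (P τ) +
      (2 - β : ℝ) * (Complex.exp (P τ * x) * P τ ^ (-(3 - β : ℝ) : ℂ)) := by
    have hw0 : P τ ^ (β : ℂ) ≠ 0 := by simp [Complex.cpow_eq_zero_iff, hP0]
    have hw1 := one_add_cpow_ne_zero hβ0.le hβ2 (hPre τ)
    have hq : ‖(P τ ^ (β : ℂ))⁻¹‖ < 1 := by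
      rw [norm_inv, Complex.norm_cpow_real, ← rpow_neg (norm_nonneg _)]
      exact rpow_lt_one_of_one_lt_of_neg (hc.trans_le (hPc τ)) (by linarith)
    have h := (hasSum_add_mul_neg_pow hq β).mul_left (Complex.exp (P τ * x) * P τ ^ (-3 : ℂ))
    have hterm (n : ℕ) : F n τ = Complex.exp (P τ * x) * P τ ^ (-3 : ℂ) *
        ((β * n + 2) * (-(P τ ^ (β : ℂ))⁻¹) ^ n) := by
      have : P τ ^ (-(β * n + 3 : ℝ) : ℂ) = ((P τ ^ (β : ℂ))⁻¹) ^ n * P τ ^ (-3 : ℂ) := by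
        rw [← Complex.cpow_neg, ← Complex.cpow_nat_mul, ← Complex.cpow_add _ _ (hP0 τ)]
        congr 1
        push_cast
        ring
      simp only [hF]
      rw [this, neg_pow (P τ ^ (β : ℂ))⁻¹]
      push_cast
      ring
    rw [tsum_congr hterm, h.tsum_eq, laplaceRemainder]
    have e1 : P τ ^ ((2 * β - 3 : ℝ) : ℂ) = P τ ^ (-3 : ℂ) * (P τ ^ (β : ℂ)) ^ 2 := by
      rw [← Complex.cpow_nat_mul, ← Complex.cpow_add _ _ (hP0 τ)]
      congr 1
      push_cast
      ring
    have e2 : P τ ^ (-(3 - β : ℝ) : ℂ) = P τ ^ (-3 : ℂ) * P τ ^ (β : ℂ) := by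
      rw [← Complex.cpow_add _ _ (hP0 τ)]
      congr 1
      push_cast
      ring
    rw [e1, e2]
    push_cast
    generalize P τ ^ (β : ℂ) = w at *
    rw [show 1 + w⁻¹ = (1 + w) / w by rw [add_div, div_self hw0, one_div, add_comm]]
    field_simp
    ring
  have hmain := (hasSum_integral_of_summable_integral_norm hFint hsum).tsum_eq
  have h3 : (1 : ℝ) < 3 - β := by linarith
  simp_rw [htsum] at hmain
  rw [integral_add (integrable_cexp_mul_laplaceRemainder hβ1 hβ2 hc0)
    ((integrable_cexp_mul_cpow_neg hc0 h3).const_mul _), integral_const_mul,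
    integral_cexp_mul_cpow_neg hc0 h3 hx, tsum_congr hFval, ← Complex.ofReal_tsum, tsum_mul_left,
    tsum_mul_left, ← mittagLeffler, ← sub_eq_iff_eq_add] at hmain
  rw [← hmain, show 3 - β - 1 = 2 - β by ring]
  push_cast
  ring

lemma eventually_mittagLeffler_neg_rpow_pos {β : ℝ} (hβ1 : 1 < β) (hβ2 : β < 2) :
    ∀ᶠ x : ℝ in atTop, 0 < mittagLeffler β 2 (-x ^ β) := by
  set C := exp 1 * (4 / cos (β * π / 4) ^ 2) * ∫ τ : ℝ, |τ| ^ (β - 2) / (1 + |τ|)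
  have hG : 0 < (2 - β) / Gamma (3 - β) :=
    div_pos (by linarith) (Gamma_pos_of_pos (by linarith))
  have hgrow : Tendsto (fun x : ℝ => (2 - β) / Gamma (3 - β) * x ^ (2 - β)) atTop atTop :=
    (tendsto_rpow_atTop (by linarith)).const_mul_atTop hG
  filter_upwards [hgrow.eventually_gt_atTop (C / (2 * π)), eventually_gt_atTop 0] with x hxC hx
  have hle := norm_integral_cexp_mul_laplaceRemainder_le (x := x) hβ1 hβ2 (inv_pos.mpr hx)
  rw [integral_cexp_mul_laplaceRemainder_eq hβ1 hβ2 (inv_pos.mpr hx) two_pos,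
    integral_cexp_mul_laplaceRemainder hβ1 hβ2 one_lt_two hx, Complex.norm_real,
    inv_mul_cancel₀ hx.ne', norm_eq_abs] at hle
  have h1 := neg_le_of_abs_le hle
  rw [div_lt_iff₀ (by positivity)] at hxC
  have h2 : (2 - β) * (x ^ (2 - β) / Gamma (3 - β)) =
    (2 - β) / Gamma (3 - β) * x ^ (2 - β) := by ring
  rw [h2] at h1
  have h3 : 0 < 2 * π * (x ^ 2 * mittagLeffler β 2 (-x ^ β)) := by linarith
  have h4 : 0 < 2 * π * x ^ 2 := by positivity
  rw [← mul_assoc] at h3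
  exact pos_of_mul_pos_right h3 h4.le

lemma analyticOnNhd_mittagLeffler {μ η : ℝ} (hμ : 1 ≤ μ) (hη : 2 ≤ η) :
    AnalyticOnNhd ℝ (mittagLeffler μ η) univ := by
  have hΓ (n : ℕ) : (n ! : ℝ) ≤ Gamma (μ * n + η) := by
    have hn : (n : ℝ) ≤ μ * n := le_mul_of_one_le_left n.cast_nonneg hμ
    have hn0 : (0 : ℝ) ≤ n := n.cast_nonneg
    calc (n ! : ℝ) ≤ ((n + 1) ! : ℝ) := by exact_mod_cast Nat.factorial_le n.le_succ
      _ = Gamma (n + 2) := by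
        rw [← Gamma_nat_eq_factorial]; congr 1; push_cast; ring
      _ ≤ Gamma (μ * n + η) := Gamma_strictMonoOn_Ici.monotoneOn
        (mem_Ici.mpr (by linarith)) (mem_Ici.mpr (by linarith)) (by linarith)
  set p := FormalMultilinearSeries.ofScalars ℝ fun n : ℕ => (Gamma (μ * n + η))⁻¹ with hp
  have hrad : p.radius = ⊤ := by
    refine p.radius_eq_top_of_summable_norm fun r => ?_
    refine .of_nonneg_of_le (fun n => by positivity) (fun n => ?_)
      (summable_pow_div_factorial (r : ℝ))
    have hn : (0 : ℝ) < n ! := by positivity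
    rw [hp, FormalMultilinearSeries.ofScalars_norm, norm_inv,
      norm_of_nonneg (hn.le.trans (hΓ n)), inv_mul_eq_div]
    exact div_le_div_of_nonneg_left (by positivity) hn (hΓ n)
  have hball := p.hasFPowerSeriesOnBall (by simp [hrad])
  have hsum : p.sum = mittagLeffler μ η := by
    ext z
    rw [mittagLeffler, hp]
    change FormalMultilinearSeries.ofScalarsSum _ z = _
    rw [FormalMultilinearSeries.ofScalars_sum_eq]
    exact tsum_congr fun n => by rw [smul_eq_mul, inv_mul_eq_div]
  rw [hsum, hrad] at hball
  simpa using hball.analyticOnNhd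

lemma mittagLeffler_zero (μ η : ℝ) : mittagLeffler μ η 0 = (Gamma η)⁻¹ := by
  rw [mittagLeffler, tsum_eq_single 0 fun n hn => by simp [hn]]
  simp

theorem finitely_many_zeros (β : ℝ) (hβ1 : 1 < β) (hβ2 : β < 2) :
    {t : ℝ | 0 < t ∧ mittagLeffler β 2 (-t) = 0}.Finite := by
  obtain ⟨X, hX⟩ := eventually_atTop.mp (eventually_mittagLeffler_neg_rpow_pos hβ1 hβ2)
  have hβ0 : 0 < β := by linarith
  by_contra hinf
  have hsub : {t : ℝ | 0 < t ∧ mittagLeffler β 2 (-t) = 0} ⊆ Icc 0 (max X 0 ^ β) := by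
    rintro t ⟨ht, hzero⟩
    refine ⟨ht.le, ?_⟩
    by_contra! hlt
    have hXt : max X 0 < t ^ β⁻¹ :=
      (lt_rpow_inv_iff_of_pos (le_max_right _ _) ht.le hβ0).mpr hlt
    have := hX (t ^ β⁻¹) ((le_max_left _ _).trans hXt.le)
    rw [rpow_inv_rpow ht.le hβ0.ne', hzero] at this
    exact this.false
  obtain ⟨t₀, -, hacc⟩ :=
    Set.Infinite.exists_accPt_of_subset_isCompact hinf isCompact_Icc hsub
  have han : AnalyticOnNhd ℝ (fun t => mittagLeffler β 2 (-t)) univ := fun t _ =>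
    (analyticOnNhd_mittagLeffler hβ1.le le_rfl (-t) trivial).fun_comp analyticAt_id.neg
  have hfreq : ∃ᶠ t in 𝓝[≠] t₀, mittagLeffler β 2 (-t) = 0 :=
    (accPt_iff_frequently_nhdsNE.mp hacc).mono fun t ht => ht.2
  have hzero := han.eqOn_zero_of_preconnected_of_frequently_eq_zero isPreconnected_univ
    (mem_univ t₀) hfreq (mem_univ 0)
  simp [mittagLeffler_zero] at hzero
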